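/- Let ψ : ℝ → ℂ² be twice differentiable and a γ₊-eigenstate of the harmonic Lévy-Leblond Hamiltonian with γ₊-eigenvalue E, i.e. (H_LL ψ)(x) = E γ₊ ψ(x) for all x. Then b†ψ is a γ₊-eigenstate with γ₊-eigenvalue E + ω: (H_LL(b†ψ))(x) = (E + ω) γ₊ (b†ψ)(x) for all x ∈ ℝ. (This follows from the commutation relation [H_LL, b†] = ω γ₊ b† together with [γ₊, b†] = 0.) -/

import Mathlib

open Matrix

noncomputable section

/-- The gamma matrix `γ¹ = [[1,0],[0,−1]]`. -/
def γ1 : Matrix (Fin 2) (Fin 2) ℂ := !![1, 0; 0, -1]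

/-- The gamma matrix `γ₊ = [[0,1],[0,0]]`. -/
def γp : Matrix (Fin 2) (Fin 2) ℂ := !![0, 1; 0, 0]

/-- The gamma matrix `γ₋ = [[0,0],[1,0]]`. -/
def γm : Matrix (Fin 2) (Fin 2) ℂ := !![0, 0; 1, 0]

/-- The harmonic Lévy-Leblond Hamiltonian:
`(H_LL ψ)(x) = β γ₋ ψ(x) − i γ¹ ψ′(x) + (k/2) x² γ₊ ψ(x)`. -/
def HLL (β k : ℝ) (ψ : ℝ → (Fin 2 → ℂ)) : ℝ → (Fin 2 → ℂ) :=
  fun x => (β : ℂ) • γm.mulVec (ψ x) - Complex.I • γ1.mulVec (deriv ψ x)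
    + ((k / 2 * x ^ 2 : ℝ) : ℂ) • γp.mulVec (ψ x)

/-- The lowering operator:
`(bψ)(x) = √(βk/2)·x·ψ(x) + ψ′(x) − i√(k/(2β)) γ₊ ψ(x)`. -/
def lower (β k : ℝ) (ψ : ℝ → (Fin 2 → ℂ)) : ℝ → (Fin 2 → ℂ) :=
  fun x => ((Real.sqrt (β * k / 2) * x : ℝ) : ℂ) • ψ x + deriv ψ x
    - (Complex.I * ((Real.sqrt (k / (2 * β)) : ℝ) : ℂ)) • γp.mulVec (ψ x)

/-- The raising operator:
`(b†ψ)(x) = √(βk/2)·x·ψ(x) − ψ′(x) − i√(k/(2β)) γ₊ ψ(x)`. -/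
def raise (β k : ℝ) (ψ : ℝ → (Fin 2 → ℂ)) : ℝ → (Fin 2 → ℂ) :=
  fun x => ((Real.sqrt (β * k / 2) * x : ℝ) : ℂ) • ψ x - deriv ψ x
    - (Complex.I * ((Real.sqrt (k / (2 * β)) : ℝ) : ℂ)) • γp.mulVec (ψ x)

/-- If `ψ` is a twice-differentiable `γ₊`-eigenstate of the harmonic
Lévy-Leblond Hamiltonian with `γ₊`-eigenvalue `E`, then `b†ψ` is a `γ₊`-eigenstate with
`γ₊`-eigenvalue `E + ω`, where `ω = √(2k/β)`. -/
theorem raise_eigenstate (β k : ℝ) (hβ : 0 < β) (hk : 0 < k) (E : ℂ)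
    (ψ : ℝ → (Fin 2 → ℂ))
    (hψ1 : Differentiable ℝ ψ) (hψ2 : Differentiable ℝ (deriv ψ))
    (heig : ∀ x : ℝ, HLL β k ψ x = E • γp.mulVec (ψ x)) :
    ∀ x : ℝ, HLL β k (raise β k ψ) x
      = (E + ((Real.sqrt (2 * k / β) : ℝ) : ℂ)) • γp.mulVec (raise β k ψ x) := by
  intro x
  obtain ⟨u, hu⟩ : ∃ u : ℝ → ℂ, u = fun y => ψ y 0 := ⟨_, rfl⟩
  obtain ⟨v, hv⟩ : ∃ v : ℝ → ℂ, v = fun y => ψ y 1 := ⟨_, rfl⟩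
  obtain ⟨up, hup⟩ : ∃ up : ℝ → ℂ, up = fun y => deriv ψ y 0 := ⟨_, rfl⟩
  obtain ⟨vp, hvp⟩ : ∃ vp : ℝ → ℂ, vp = fun y => deriv ψ y 1 := ⟨_, rfl⟩
  have hD : ∀ y, HasDerivAt ψ (deriv ψ y) y := fun y => (hψ1 y).hasDerivAt
  have hD2 : ∀ y, HasDerivAt (deriv ψ) (deriv (deriv ψ) y) y := fun y => (hψ2 y).hasDerivAt
  have du : ∀ y, HasDerivAt u (up y) y := fun y => by
    subst hu hup; exact (hasDerivAt_pi.1 (hD y)) 0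
  have dv : ∀ y, HasDerivAt v (vp y) y := fun y => by
    subst hv hvp; exact (hasDerivAt_pi.1 (hD y)) 1
  have dup : HasDerivAt up (deriv (deriv ψ) x 0) x := by
    subst hup; exact (hasDerivAt_pi.1 (hD2 x)) 0
  have dvp : HasDerivAt vp (deriv (deriv ψ) x 1) x := by
    subst hvp; exact (hasDerivAt_pi.1 (hD2 x)) 1
  generalize deriv (deriv ψ) x 0 = u2 at dup
  generalize deriv (deriv ψ) x 1 = v2 at dvp
  have e0 : ∀ y : ℝ, -Complex.I * up y + (k / 2 * (y:ℂ) ^ 2) * v y = E * v y := fun y => by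
    have := congrFun (heig y) 0
    simp [HLL, γ1, γp, γm, Matrix.mulVec, dotProduct, Fin.sum_univ_two] at this
    subst hup hv
    simp only
    linear_combination this
  have e1 : ∀ y : ℝ, vp y = Complex.I * β * u y := fun y => by
    have := congrFun (heig y) 1
    simp [HLL, γ1, γp, γm, Matrix.mulVec, dotProduct, Fin.sum_univ_two] at this
    subst hvp hu
    simp only
    linear_combination (-Complex.I) * this + deriv ψ y 1 * Complex.I_sq
  have hv2 : v2 = Complex.I * β * up x := by
    have h : vp = fun y => Complex.I * β * u y := funext e1
    rw [h] at dvp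
    exact dvp.unique ((du x).const_mul _)
  have hx : HasDerivAt (fun y : ℝ => (y : ℂ)) 1 x := Complex.ofRealCLM.hasDerivAt
  have hu2 : -Complex.I * u2 + k * x * v x + (k / 2 * (x:ℂ) ^ 2) * vp x = E * vp x := by
    have h1 := (dup.const_mul (-Complex.I)).add (((hx.pow 2).const_mul ((k:ℂ)/2)).mul (dv x))
    have h2 := (dv x).const_mul E
    rw [← funext e0] at h2
    have := h1.unique h2
    simp at this
    linear_combination this
  obtain ⟨t, ht⟩ : ∃ t : ℝ, t = Real.sqrt (k / (2 * β)) := ⟨_, rfl⟩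
  have ht0 : 0 ≤ t := ht ▸ Real.sqrt_nonneg _
  have htt : t ^ 2 = k / (2 * β) := by rw [ht]; exact Real.sq_sqrt (by positivity)
  have hs : Real.sqrt (β * k / 2) = β * t := by
    rw [Real.sqrt_eq_iff_mul_self_eq (by positivity) (by positivity)]
    have : β * t * (β * t) = β ^ 2 * t ^ 2 := by ring
    rw [this, htt]; field_simp
  have hw : Real.sqrt (2 * k / β) = 2 * t := by
    rw [Real.sqrt_eq_iff_mul_self_eq (by positivity) (by positivity)]
    have : 2 * t * (2 * t) = 4 * t ^ 2 := by ring
    rw [this, htt]; field_simp; norm_num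
  have hk2 : (k : ℂ) = 2 * β * (t:ℂ) ^ 2 := by
    have : k = 2 * β * t ^ 2 := by rw [htt]; field_simp
    exact_mod_cast this
  have r : raise β k ψ = fun y => ![β * t * y * u y - up y - Complex.I * t * v y,
      β * t * y * v y - vp y] := by
    subst hu hv hup hvp
    funext y i
    fin_cases i <;>
      simp [raise, γp, hs, ← ht, Matrix.mulVec, dotProduct, Fin.sum_univ_two]
  have dr : HasDerivAt (raise β k ψ)
      ![β * t * u x + β * t * x * up x - u2 - Complex.I * t * vp x,
        β * t * v x + β * t * x * vp x - v2] x := by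
    rw [r]
    have hbx := hx.const_mul ((β : ℂ) * t)
    rw [mul_one] at hbx
    refine hasDerivAt_pi.2 fun i => ?_
    fin_cases i
    · exact ((hbx.mul (du x)).sub dup).sub ((dv x).const_mul (Complex.I * t))
    · exact (hbx.mul (dv x)).sub dvp
  have E1 := e1 x
  have E0 := e0 x
  unfold HLL
  rw [dr.deriv, r, hw]
  funext i
  fin_cases i
  · simp [γ1, γp, γm, Matrix.mulVec, dotProduct, Fin.sum_univ_two]
    linear_combination -hu2 + β * t * x * E0 + x * v x * hk2 + t * vp x * Complex.I_sq + t * E1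
  · simp [γ1, γp, γm, Matrix.mulVec, dotProduct, Fin.sum_univ_two]
    linear_combination -Complex.I * hv2 + Complex.I * β * t * x * E1 + (-β * up x + β ^ 2 * t * x * u x) * Complex.I_sq

end
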